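/- Let F be a finite field with |F| = q, let k ≥ 1, let V be a 2k-dimensional F-vector space, and let m, k1, k2 be integers with 0 ≤ k1 ≤ k2 and k1 + k2 ≤ m ≤ k. If Proj^{m,k}_{(k1,k2)}(V) is collinearly complete, then 3·k2 ≤ k + 1 + m + k1. -/

import Mathlib

open Module

/-- `{V₁, V₂}` is a bisection of `V` into two `k`-dimensional subspaces. -/
def IsBisection {F V : Type*} [Field F] [AddCommGroup V] [Module F V]
    (k : ℕ) (V₁ V₂ : Submodule F V) : Prop :=
  finrank F V₁ = k ∧ finrank F V₂ = k ∧ V₁ ⊓ V₂ = ⊥ ∧ V₁ ⊔ V₂ = ⊤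

/-- The unordered pair of intersection dimensions of `U` with `V₁, V₂` is `(k₁, k₂)`. -/
def Incident {F V : Type*} [Field F] [AddCommGroup V] [Module F V]
    (k₁ k₂ : ℕ) (U V₁ V₂ : Submodule F V) : Prop :=
  (finrank F ↥(U ⊓ V₁) = k₁ ∧ finrank F ↥(U ⊓ V₂) = k₂) ∨
  (finrank F ↥(U ⊓ V₁) = k₂ ∧ finrank F ↥(U ⊓ V₂) = k₁)

/-- Collinear completeness of the geometry `Proj^{m,k}_{(k₁,k₂)}(V)`. -/
def CollinearlyComplete (F V : Type*) [Field F] [AddCommGroup V] [Module F V]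
    (m k k₁ k₂ : ℕ) : Prop :=
  ∀ U₁ U₂ : Submodule F V, finrank F U₁ = m → finrank F U₂ = m → U₁ ≠ U₂ →
    ∃ V₁ V₂ : Submodule F V, IsBisection k V₁ V₂ ∧
      Incident k₁ k₂ U₁ V₁ V₂ ∧ Incident k₁ k₂ U₂ V₁ V₂

/-- Two `m`-dimensional subspaces with intersection of prescribed dimension `t` exist when the
ambient space has room for their sum. -/
lemma exists_finrank_inf_eq {F V : Type*} [Field F] [AddCommGroup V] [Module F V]
    [FiniteDimensional F V] {m t : ℕ} (htm : t ≤ m) (hV : 2 * m ≤ finrank F V + t) :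
    ∃ U₁ U₂ : Submodule F V, finrank F U₁ = m ∧ finrank F U₂ = m ∧
      finrank F ↥(U₁ ⊓ U₂) = t := by
  classical
  let b := finBasis F V
  have finrank_span (s : Finset (Fin (finrank F V))) :
      finrank F (Submodule.span F (b '' s)) = s.card := by
    rw [← Finset.coe_image, finrank_span_finset_eq_card,
      Finset.card_image_of_injective _ b.injective]
    have h := (b.linearIndependent.comp (Subtype.val : s → _) Subtype.val_injective).linearIndepOn_id
    rw [Set.range_comp] at h
    simpa using h
  obtain ⟨s, -, hs⟩ := Finset.exists_subset_card_eq
    (s := (Finset.univ : Finset (Fin (finrank F V)))) (n := 2 * m - t) (by simp; omega)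
  obtain ⟨s₁, hs₁, hcard₁⟩ := Finset.exists_subset_card_eq (s := s) (n := m) (by omega)
  have hsdiff : (s \ s₁).card = m - t := by
    rw [Finset.card_sdiff_of_subset hs₁]
    omega
  obtain ⟨s₂, hs₂, hs₂s, hcard₂⟩ := Finset.exists_subsuperset_card_eq (n := m)
    (Finset.sdiff_subset : s \ s₁ ⊆ s) (by omega) (by omega)
  have hunion : s₁ ∪ s₂ = s := by
    refine (Finset.union_subset hs₁ hs₂s).antisymm ?_
    rw [← Finset.union_sdiff_of_subset hs₁]
    exact Finset.union_subset_union_right hs₂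
  refine ⟨Submodule.span F (b '' s₁), Submodule.span F (b '' s₂), ?_, ?_, ?_⟩
  · rw [finrank_span, hcard₁]
  · rw [finrank_span, hcard₂]
  · have h := Submodule.finrank_sup_add_finrank_inf_eq
      (Submodule.span F (b '' s₁)) (Submodule.span F (b '' s₂))
    rw [← Submodule.span_union, ← Set.image_union, ← Finset.coe_union, hunion] at h
    simp only [finrank_span] at h
    omega

lemma finrank_inf_add_finrank_inf_le {F V : Type*} [Field F] [AddCommGroup V] [Module F V]
    [FiniteDimensional F V] (A B C : Submodule F V) :
    finrank F ↥(A ⊓ C) + finrank F ↥(B ⊓ C) ≤ finrank F C + finrank F ↥(A ⊓ B) := by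
  rw [← Submodule.finrank_sup_add_finrank_inf_eq]
  exact add_le_add (Submodule.finrank_mono (sup_le inf_le_right inf_le_right))
    (Submodule.finrank_mono (inf_le_inf inf_le_left inf_le_left))

lemma finrank_inf_add_finrank_inf_le' {F V : Type*} [Field F] [AddCommGroup V] [Module F V]
    [FiniteDimensional F V] (A B C : Submodule F V) :
    finrank F ↥(A ⊓ C) + finrank F ↥(A ⊓ B) ≤ finrank F A + finrank F ↥(B ⊓ C) := by
  rw [inf_comm A C, inf_comm A B, inf_comm B C]
  exact finrank_inf_add_finrank_inf_le C B A

theorem necessary_condition_collinearlyComplete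
    (F V : Type*) [Field F] [Fintype F] [AddCommGroup V] [Module F V]
    [FiniteDimensional F V] (q k m k₁ k₂ : ℕ)
    (hq : Fintype.card F = q) (hk : 1 ≤ k) (hV : finrank F V = 2 * k)
    (hk₁₂ : k₁ ≤ k₂) (hmlow : k₁ + k₂ ≤ m) (hmk : m ≤ k)
    (hcc : CollinearlyComplete F V m k k₁ k₂) :
    3 * k₂ ≤ k + 1 + m + k₁ := by
  by_contra! hlt
  obtain ⟨U₁, U₂, h₁, h₂, hinf⟩ := exists_finrank_inf_eq (F := F) (V := V) (m := m)
    (t := k₁ + m + 1 - k₂) (by omega) (by omega)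
  have hne : U₁ ≠ U₂ := by
    rintro rfl
    rw [inf_idem] at hinf
    omega
  obtain ⟨V₁, V₂, ⟨hV₁, hV₂, -, -⟩, hU₁, hU₂⟩ := hcc U₁ U₂ h₁ h₂ hne
  have := finrank_inf_add_finrank_inf_le U₁ U₂ V₁
  have := finrank_inf_add_finrank_inf_le U₁ U₂ V₂
  have := finrank_inf_add_finrank_inf_le' U₁ U₂ V₁
  have := finrank_inf_add_finrank_inf_le' U₁ U₂ V₂
  rcases hU₁ with ⟨_, _⟩ | ⟨_, _⟩ <;> rcases hU₂ with ⟨_, _⟩ | ⟨_, _⟩ <;> omega
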